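/- Let 0 ≤ m ≤ n be integers and let Q = Σ_{l=m}^n Σ_{k=−l}^l c_{l,k} Y_l^k ∈ Π_n^m, with coefficient vectors c_k = (c_{m,k}, …, c_{n,k}) for −m ≤ k ≤ m and c_k = (c_{|k|,k}, …, c_{n,k}) for m+1 ≤ |k| ≤ n. Then ε(Q) = ⟨P_n^m M P_n^m Q, Q⟩ = Σ_{k=−m}^m c_k^H J(|k|)_{n−|k|}^{m−|k|} c_k + Σ_{m+1 ≤ |k| ≤ n} c_k^H J(|k|)_{n−|k|} c_k. Consequently, the operator P_n^m M P_n^m restricted to Π_n^m is unitarily equivalent, via the unitary map sending the canonical basis vectors to the spherical harmonics Y_l^k, to the block diagonal matrix 𝒥_n^m ∈ ℂ^{N_n^m × N_n^m} whose blocks are the Jacobi matrices J(|k|)_{n−|k|}^{m−|k|} for −m ≤ k ≤ m and J(|k|)_{n−|k|} for m+1 ≤ |k| ≤ n. -/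

import Mathlib

open MeasureTheory Finset

noncomputable section

namespace SFT

/-- The recurrence coefficients `b_l^{(α)}` of the orthonormal ultraspherical polynomials. -/
def b (α : ℝ) : ℕ → ℝ
  | 0 => Real.sqrt (Real.sqrt Real.pi * Real.Gamma (α + 1) / (2 * Real.Gamma (α + 3 / 2)))
  | l + 1 => Real.sqrt ((((l : ℝ) + 1) * (((l : ℝ) + 1) + 2 * α)) /
      ((2 * ((l : ℝ) + 1) + 2 * α + 1) * (2 * ((l : ℝ) + 1) + 2 * α - 1)))

/-- The associated ultraspherical polynomials: `pA α m l x = p_l^{(α)}(x, m)`.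
For `m = 0` these are the orthonormal ultraspherical polynomials `p_l^{(α)}(x)`. -/
def pA (α : ℝ) (m : ℕ) : ℕ → ℝ → ℝ
  | 0, _ => 1 / b α m
  | 1, x => x * (1 / b α m) / b α (m + 1)
  | l + 2, x => (x * pA α m (l + 1) x - b α (m + l + 1) * pA α m l x) / b α (m + l + 2)

/-- The orthonormal ultraspherical polynomials `p_l^{(α)}(x)`. -/
def p (α : ℝ) (l : ℕ) (x : ℝ) : ℝ := pA α 0 l x

/-- Ultraspherical polynomials with integer index; in particular `p_{-1}^{(α)} = 0`. -/
def pZ (α : ℝ) (l : ℤ) (x : ℝ) : ℝ := if 0 ≤ l then p α l.toNat x else 0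

/-- `JE α M i j` is the `(i,j)` entry (`0`-based) of the truncated Jacobi matrix
`J(α)_L^M` (of any size `L − M + 1`). -/
def JE (α : ℝ) (M : ℕ) (i j : ℕ) : ℝ :=
  if i + 1 = j then b α (M + i + 1) else if j + 1 = i then b α (M + j + 1) else 0

/-- The truncated Jacobi matrix `J(α)_{M+l}^M`, of size `(l+1) × (l+1)`.
In particular `Jt α 0 l` is the Jacobi matrix `J(α)_l`. -/
def Jt (α : ℝ) (M l : ℕ) : Matrix (Fin (l + 1)) (Fin (l + 1)) ℝ :=
  fun i j => JE α M i.1 j.1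

/-- The spherical harmonics `Y_l^k(θ, φ)`. -/
def Y (l : ℕ) (k : ℤ) (θ φ : ℝ) : ℂ :=
  ((Real.sin θ ^ k.natAbs : ℝ) : ℂ) * ((p (k.natAbs : ℝ) (l - k.natAbs) (Real.cos θ) : ℝ) : ℂ) *
    Complex.exp (Complex.I * (k : ℂ) * (φ : ℂ))

/-- Parameter region `[0, π] × [0, 2π]` of spherical coordinates. -/
def region : Set (ℝ × ℝ) := Set.Icc (0 : ℝ) Real.pi ×ˢ Set.Icc (0 : ℝ) (2 * Real.pi)

/-- The inner product of `L²(S²)`. -/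
def inner2 (f g : ℝ → ℝ → ℂ) : ℂ :=
  (1 / (4 * Real.pi)) *
    ∫ q in region, f q.1 q.2 * (starRingEnd ℂ) (g q.1 q.2) * ((Real.sin q.1 : ℝ) : ℂ)

/-- The norm of `L²(S²)`. -/
def norm2 (f : ℝ → ℝ → ℂ) : ℝ := Real.sqrt (inner2 f f).re

/-- Membership in `L²(S²)`. -/
def MemL2 (f : ℝ → ℝ → ℂ) : Prop :=
  Measurable (fun q : ℝ × ℝ => f q.1 q.2) ∧
    IntegrableOn (fun q : ℝ × ℝ => ‖f q.1 q.2‖ ^ 2 * Real.sin q.1) region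

/-- The multiplication operator `M`. -/
def Mop (f : ℝ → ℝ → ℂ) : ℝ → ℝ → ℂ := fun θ φ => ((Real.cos θ : ℝ) : ℂ) * f θ φ

/-- The power `M^j` of the multiplication operator. -/
def Mpow (j : ℕ) (f : ℝ → ℝ → ℂ) : ℝ → ℝ → ℂ := fun θ φ => ((Real.cos θ : ℝ) : ℂ) ^ j * f θ φ

/-- The mean value `ε(f)`. -/
def eps (f : ℝ → ℝ → ℂ) : ℝ :=
  (1 / (4 * Real.pi)) * ∫ q in region, Real.cos q.1 * ‖f q.1 q.2‖ ^ 2 * Real.sin q.1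

/-- The projection `P_n^m` onto `Π_n^m`. -/
def Pr (n m : ℕ) (f : ℝ → ℝ → ℂ) : ℝ → ℝ → ℂ :=
  fun θ φ => ∑ l ∈ Finset.Icc m n, ∑ k ∈ Finset.Icc (-(l : ℤ)) (l : ℤ),
    inner2 f (Y l k) * Y l k θ φ

/-- The space–frequency operator `P_n^m M P_n^m`. -/
def SFop (n m : ℕ) (f : ℝ → ℝ → ℂ) : ℝ → ℝ → ℂ := Pr n m (Mop (Pr n m f))

/-- The space `Π_n^m`, spanned by the spherical harmonics `Y_l^k`, `m ≤ l ≤ n`, `|k| ≤ l`. -/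
def Pi_nm (n m : ℕ) : Submodule ℂ (ℝ → ℝ → ℂ) :=
  Submodule.span ℂ {g | ∃ l : ℕ, ∃ k : ℤ, m ≤ l ∧ l ≤ n ∧ k.natAbs ≤ l ∧ g = Y l k}

/-- `N_k = n − max(|k|, m) + 1`. -/
def Nk (n m k : ℕ) : ℕ := n - max k m + 1

/-- The normalizing constant `κ_{k,i}`, given the corresponding root value `xr`. -/
def kap (n m k : ℕ) (xr : ℝ) : ℝ :=
  (Real.sqrt (∑ l ∈ Finset.Icc (max k m) n, (pA (k : ℝ) (m - k) (l - max k m) xr) ^ 2))⁻¹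

/-- The eigenfunction `ψ_{k,i}`, given the corresponding root value `xr`. -/
def psiFun (n m : ℕ) (k : ℤ) (xr : ℝ) : ℝ → ℝ → ℂ :=
  fun θ φ => ((kap n m k.natAbs xr : ℝ) : ℂ) *
    ∑ l ∈ Finset.Icc (max k.natAbs m) n,
      ((pA (k.natAbs : ℝ) (m - k.natAbs) (l - max k.natAbs m) xr : ℝ) : ℂ) * Y l k θ φ

lemma b_pos (a : ℕ) (l : ℕ) : 0 < b (a : ℝ) l := by
  cases l with
  | zero =>
    simp only [b]
    apply Real.sqrt_pos.mpr
    have h1 : 0 < Real.Gamma ((a : ℝ) + 1) := Real.Gamma_pos_of_pos (by positivity)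
    have h2 : 0 < Real.Gamma ((a : ℝ) + 3 / 2) := Real.Gamma_pos_of_pos (by positivity)
    have h3 := Real.pi_pos
    positivity
  | succ l =>
    simp only [b]
    apply Real.sqrt_pos.mpr
    have : (0 : ℝ) < 2 * ((l : ℝ) + 1) + 2 * a - 1 := by
      have : (0 : ℝ) ≤ l := by positivity
      have : (0 : ℝ) ≤ a := by positivity
      linarith
    positivity

lemma b_sq (a l : ℕ) : (2 * (l : ℝ) + 2 * a + 3) * (2 * (l : ℝ) + 2 * a + 1) * b (a : ℝ) (l + 1) ^ 2
    = ((l : ℝ) + 1) * ((l : ℝ) + 1 + 2 * a) := by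
  have h : (0 : ℝ) < 2 * ((l : ℝ) + 1) + 2 * a - 1 := by
    have : (0 : ℝ) ≤ l := by positivity
    have : (0 : ℝ) ≤ a := by positivity
    linarith
  simp only [b]
  rw [Real.sq_sqrt (by positivity), mul_div_assoc', div_eq_iff (by positivity)]
  ring

lemma b_zero_sq (a : ℕ) : (∫ θ in (0:ℝ)..Real.pi, Real.sin θ ^ (2 * a + 1)) = 2 * b (a : ℝ) 0 ^ 2 := by
  have h1 : 0 < Real.Gamma ((a : ℝ) + 1) := Real.Gamma_pos_of_pos (by positivity)
  have h2 : 0 < Real.Gamma ((a : ℝ) + 3 / 2) := Real.Gamma_pos_of_pos (by positivity)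
  have h3 := Real.pi_pos
  simp only [b]
  rw [Real.sq_sqrt (by positivity), integral_sin_pow_odd]
  clear h1 h2
  induction a with
  | zero =>
    have : Real.Gamma (3 / 2) = (1 / 2) * Real.sqrt Real.pi := by
      rw [show (3 / 2 : ℝ) = 1 / 2 + 1 by norm_num, Real.Gamma_add_one (by norm_num),
        Real.Gamma_one_half_eq]
    have := Real.sqrt_ne_zero'.mpr h3
    simp_all
  | succ a ih =>
    rw [Finset.prod_range_succ, ← mul_assoc, ih]
    push_cast
    have h2 : 0 < Real.Gamma ((a : ℝ) + 3 / 2) := Real.Gamma_pos_of_pos (by positivity)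
    rw [show (a : ℝ) + 1 + 3 / 2 = (a + 3 / 2) + 1 by ring, Real.Gamma_add_one (s := (a : ℝ) + 3 / 2) (by positivity),
      Real.Gamma_add_one (s := (a : ℝ) + 1) (by positivity)]
    field_simp

lemma p_zero (α x : ℝ) : p α 0 x = 1 / b α 0 := by simp [p, pA]

lemma p_rec0 (a : ℕ) (x : ℝ) : x * p (a : ℝ) 0 x = b a 1 * p a 1 x := by
  have := (b_pos a 1).ne'
  simp only [p, pA]
  field_simp

lemma p_rec (a l : ℕ) (x : ℝ) :
    x * p (a : ℝ) (l + 1) x = b a (l + 2) * p a (l + 2) x + b a (l + 1) * p a l x := by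
  have := (b_pos a (l + 2)).ne'
  simp only [p, pA, zero_add]
  field_simp
  ring

/-- Structure relation `(1 - x²) p_n' = (n + 2α + 1) x p_n - (2n + 2α + 1) b_{n+1} p_{n+1}`. -/
lemma p_deriv (a : ℕ) (x : ℝ) (n : ℕ) : (∃ d, HasDerivAt (p (a : ℝ) n) d x ∧
    (1 - x ^ 2) * d = (n + 2 * a + 1) * x * p a n x - (2 * n + 2 * a + 1) * b a (n + 1) * p a (n + 1) x)
    ∧ (∃ d, HasDerivAt (p (a : ℝ) (n + 1)) d x ∧
    (1 - x ^ 2) * d = (n + 1 + 2 * a + 1) * x * p a (n + 1) x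
      - (2 * (n + 1) + 2 * a + 1) * b a (n + 2) * p a (n + 2) x) := by
  induction n with
  | zero =>
    constructor
    · refine ⟨0, ?_, ?_⟩
      · have : p (a : ℝ) 0 = fun _ => 1 / b (a : ℝ) 0 := by funext y; exact p_zero _ _
        rw [this]; exact hasDerivAt_const _ _
      · have := p_rec0 a x
        simp only [Nat.cast_zero, zero_add]
        linear_combination (-(2 * (a : ℝ) + 1)) * this
    · refine ⟨1 / b (a : ℝ) 0 / b (a : ℝ) 1, ?_, ?_⟩
      · have : p (a : ℝ) (0 + 1) = fun x => x * (1 / b (a : ℝ) 0) / b (a : ℝ) 1 := by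
          funext y; simp [p, pA]
        rw [this]
        simpa using ((hasDerivAt_id x).mul_const (1 / b (a : ℝ) 0)).div_const (b (a : ℝ) 1)
      · have h0 := p_rec0 a x
        have h1 := p_rec a 0 x
        have hb := b_sq a 0
        have hb1 := (b_pos a 1).ne'
        rw [← p_zero (a : ℝ) x]
        simp only [Nat.cast_zero, zero_add, mul_one, mul_zero] at *
        have e : (3 + 2 * (a : ℝ)) * b (a : ℝ) 1 ^ 2 = 1 := by
          have : (2 * (a : ℝ) + 1) ≠ 0 := by positivity
          apply mul_left_cancel₀ this
          linear_combination hb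
        field_simp
        linear_combination (-(x)) * h0 - (2 * (a : ℝ) + 3) * b (a : ℝ) 1 * h1 - p a 0 x * e
  | succ n ih =>
    obtain ⟨⟨d0, hd0, e0⟩, d1, hd1, e1⟩ := ih
    refine ⟨⟨d1, hd1, ?_⟩, ?_⟩
    · push_cast; linear_combination e1
    · refine ⟨(p a (n + 1) x + x * d1 - b a (n + 1) * d0) / b a (n + 2), ?_, ?_⟩
      · have : p (a : ℝ) (n + 1 + 1) = fun x =>
            (x * p a (n + 1) x - b a (n + 1) * p a n x) / b a (n + 2) := by
          funext y; simp [p, pA]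
        rw [this]
        simpa using (((hasDerivAt_id x).mul hd1).sub (hd0.const_mul (b (a : ℝ) (n + 1)))).div_const
          (b (a : ℝ) (n + 2))
      · have hb1 := (b_pos a (n + 2)).ne'
        have h1 := p_rec a n x
        have h2 := p_rec a (n + 1) x
        have q1 := b_sq a n
        have q2 := b_sq a (n + 1)
        push_cast at q2 ⊢
        have e : 1 + (2 * (n : ℝ) + 2 * a + 1) * b a (n + 1) ^ 2
            = (2 * n + 2 * a + 5) * b a (n + 2) ^ 2 := by
          have : (2 * (n : ℝ) + 2 * a + 3) ≠ 0 := by positivity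
          apply mul_left_cancel₀ this
          linear_combination q1 - q2
        rw [mul_div_assoc', div_eq_iff hb1]
        linear_combination x * e1 - b a (n + 1) * e0 + (n + 1 + 2 * (a : ℝ)) * x * h1
          - (2 * (n : ℝ) + 2 * a + 5) * b a (n + 2) * h2 + p a (n + 1) x * e

lemma p_cont (a n : ℕ) : Continuous (p (a : ℝ) n) := by
  rw [continuous_iff_continuousAt]
  intro x
  obtain ⟨⟨d, hd, _⟩, _⟩ := p_deriv a x n
  exact hd.continuousAt

/-- Integration against the ultraspherical weight in the variable `θ`. -/
def Iw (a : ℕ) (f : ℝ → ℝ) : ℝ := ∫ θ in (0:ℝ)..Real.pi, Real.sin θ ^ (2 * a + 1) * f (Real.cos θ)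

lemma Iw_lin (a : ℕ) (s t : ℝ) (f g : ℝ → ℝ) (hf : Continuous f) (hg : Continuous g) :
    Iw a (fun x => s * f x + t * g x) = s * Iw a f + t * Iw a g := by
  unfold Iw
  rw [← intervalIntegral.integral_const_mul, ← intervalIntegral.integral_const_mul,
    ← intervalIntegral.integral_add]
  · congr 1; funext θ; ring
  · exact Continuous.intervalIntegrable (by fun_prop) _ _
  · exact Continuous.intervalIntegrable (by fun_prop) _ _

lemma Iw_mul (a : ℕ) (s : ℝ) (f : ℝ → ℝ) :
    Iw a (fun x => s * f x) = s * Iw a f := by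
  unfold Iw
  rw [← intervalIntegral.integral_const_mul]
  congr 1; funext θ; ring

lemma Iw_parts (a n : ℕ) : (2 * (a : ℝ) + 2 - (n + 2 * a + 1)) * Iw a (fun x => x * p a n x)
    + (2 * n + 2 * a + 1) * b a (n + 1) * Iw a (p a (n + 1)) = 0 := by
  have hc := p_cont a n
  have hc' := p_cont a (n + 1)
  rw [← Iw_lin a _ _ _ _ (by fun_prop) hc']
  unfold Iw
  have := intervalIntegral.integral_eq_sub_of_hasDerivAt
    (a := 0) (b := Real.pi) (f := fun θ => Real.sin θ ^ (2 * a + 2) * p a n (Real.cos θ))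
    (f' := fun θ => Real.sin θ ^ (2 * a + 1) * ((2 * (a : ℝ) + 2 - (n + 2 * a + 1)) *
      (Real.cos θ * p a n (Real.cos θ)) +
      (2 * n + 2 * a + 1) * b a (n + 1) * p a (n + 1) (Real.cos θ))) ?_ ?_
  · rw [this]; simp
  · intro θ _
    obtain ⟨⟨d, hd, e⟩, _⟩ := p_deriv a (Real.cos θ) n
    have h1 := ((Real.hasDerivAt_sin θ).pow (2 * a + 2)).mul
      (HasDerivAt.comp θ hd (Real.hasDerivAt_cos θ))
    refine h1.congr_deriv ?_
    have hs := Real.sin_sq_add_cos_sq θ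
    simp only [Function.comp, Pi.pow_apply, show 2 * a + 2 - 1 = 2 * a + 1 by omega]
    push_cast
    linear_combination (-Real.sin θ ^ (2 * a + 1)) * e
      - Real.sin θ ^ (2 * a + 1) * d * hs
  · exact Continuous.intervalIntegrable (by fun_prop) _ _

lemma Iw_p (a n : ℕ) : Iw a (p a (n + 1)) = 0 := by
  induction n using Nat.strong_induction_on with
  | _ n ih =>
  have hp := Iw_parts a n
  have hb := (b_pos a (n + 1)).ne'
  have ha : (0 : ℝ) ≤ a := by positivity
  match n with
  | 0 =>
    have : Iw a (fun x => x * p a 0 x) = b a 1 * Iw a (p a 1) := by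
      rw [← Iw_mul]; congr 1; funext x; exact p_rec0 a x
    rw [this] at hp
    push_cast at hp
    simp only [zero_add] at *
    have : (2 * (a : ℝ) + 2) * (b a 1 * Iw a (p a 1)) = 0 := by linear_combination hp
    have h3 : (2 * (a : ℝ) + 2) ≠ 0 := by positivity
    simpa [h3, hb] using this
  | k + 1 =>
    have : Iw a (fun x => x * p a (k + 1) x) = b a (k + 2) * Iw a (p a (k + 2))
        + b a (k + 1) * Iw a (p a k) := by
      rw [← Iw_lin _ _ _ _ _ (p_cont _ _) (p_cont _ _)]
      congr 1; funext x; exact p_rec a k x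
    rw [this] at hp
    push_cast at hp
    have h3 : ((k : ℝ) + 2 * a + 3) ≠ 0 := by positivity
    have hz : (k : ℝ) * Iw a (p a k) = 0 := by
      match k with
      | 0 => simp
      | j + 1 => rw [ih j (by omega)]; simp
    have : ((k : ℝ) + 2 * a + 3) * (b a (k + 2) * Iw a (p a (k + 2))) = 0 := by
      linear_combination hp + b a (k + 1) * hz
    simpa [h3, hb] using this

lemma gram_abs (β : ℕ → ℝ) (hβ : ∀ i, β i ≠ 0) (g X : ℕ → ℕ → ℝ) (c : ℝ)
    (h0 : ∀ j, X 0 j = β 1 * g 1 j)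
    (h1 : ∀ i j, X (i + 1) j = β (i + 2) * g (i + 2) j + β (i + 1) * g i j)
    (h2 : ∀ i, X i 0 = β 1 * g i 1)
    (h3 : ∀ i j, X i (j + 1) = β (j + 2) * g i (j + 2) + β (j + 1) * g i j)
    (h4 : ∀ i, g i 0 = if i = 0 then c else 0) :
    ∀ j, (∀ i, g i j = if i = j then c else 0) ∧ (∀ i, g i (j + 1) = if i = j + 1 then c else 0) := by
  intro j
  induction j with
  | zero =>
    refine ⟨h4, fun i => ?_⟩
    apply mul_left_cancel₀ (hβ 1)
    rw [zero_add, ← h2]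
    match i with
    | 0 => rw [h0, h4]; simp
    | 1 => rw [h1, h4, h4]; simp
    | i + 2 => rw [h1, h4, h4]; simp
  | succ j ih =>
    obtain ⟨ih0, ih1⟩ := ih
    refine ⟨ih1, fun i => ?_⟩
    apply mul_left_cancel₀ (hβ (j + 2))
    have := h3 i j
    rw [ih0] at this
    have e : β (j + 2) * g i (j + 1 + 1) = X i (j + 1) - β (j + 1) * (if i = j then c else 0) := by
      rw [this]; ring
    rw [e]
    match i with
    | 0 => 
      rw [h0, ih1]
      by_cases hj : j = 0
      · subst hj; simp
      · have : (0 : ℕ) ≠ j := fun h => hj h.symm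
        simp [hj, this]
    | i + 1 =>
      rw [h1, ih1, ih1]
      rcases lt_trichotomy (i + 1) j with h | h | h
      · rw [if_neg (by omega), if_neg (by omega), if_neg (by omega), if_neg (by omega)]; simp
      · subst h; simp; intros; omega
      · by_cases h' : i = j + 1
        · subst h'; simp; intros; omega
        · rw [if_neg (by omega)]
          by_cases h5 : i = j
          · subst h5; simp
          · rw [if_neg (by omega), if_neg (by omega), if_neg (by omega)]; simp

lemma gram (a i j : ℕ) : Iw a (fun x => p a i x * p a j x) = if i = j then 2 else 0 := by
  have hc := p_cont a
  refine (gram_abs (b a) (fun i => (b_pos a i).ne') (fun i j => Iw a (fun x => p a i x * p a j x))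
    (fun i j => Iw a (fun x => x * p a i x * p a j x)) 2 ?_ ?_ ?_ ?_ ?_ j).1 i
  · intro j
    rw [← Iw_mul]; congr 1; funext x; rw [p_rec0]; ring
  · intro i j
    rw [← Iw_lin _ _ _ _ _ (by fun_prop) (by fun_prop)]; congr 1; funext x; rw [p_rec]; ring
  · intro i
    rw [← Iw_mul]; congr 1; funext x; linear_combination p a i x * p_rec0 a x
  · intro i j
    rw [← Iw_lin _ _ _ _ _ (by fun_prop) (by fun_prop)]; congr 1; funext x
    linear_combination p a i x * p_rec a j x
  · intro i
    have hb := (b_pos a 0).ne'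
    have : Iw a (fun x => p a i x * p a 0 x) = 1 / b a 0 * Iw a (p a i) := by
      rw [← Iw_mul]; congr 1; funext x; rw [p_zero]; ring
    rw [this]
    match i with
    | 0 =>
      have : Iw a (p a 0) = 1 / b a 0 * (2 * b (a : ℝ) 0 ^ 2) := by
        rw [← b_zero_sq, ← intervalIntegral.integral_const_mul]
        unfold Iw; congr 1; funext x; rw [p_zero]; ring
      rw [this]; simp; field_simp
    | i + 1 => rw [Iw_p]; simp

/-- Joint continuity. -/
def JC (f : ℝ → ℝ → ℂ) : Prop := Continuous (fun q : ℝ × ℝ => f q.1 q.2)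

lemma Y_JC (l : ℕ) (k : ℤ) : JC (Y l k) := by
  have := p_cont k.natAbs (l - k.natAbs)
  unfold JC Y
  fun_prop

lemma Mop_JC {f : ℝ → ℝ → ℂ} (h : JC f) : JC (Mop f) := by
  unfold JC at *
  unfold Mop
  fun_prop

lemma region_compact : IsCompact region := isCompact_Icc.prod isCompact_Icc

lemma inner2_int {f g : ℝ → ℝ → ℂ} (hf : JC f) (hg : JC g) :
    Integrable (fun q : ℝ × ℝ => f q.1 q.2 * (starRingEnd ℂ) (g q.1 q.2) * ((Real.sin q.1 : ℝ) : ℂ))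
      (volume.restrict region) := by
  apply ContinuousOn.integrableOn_compact region_compact
  apply Continuous.continuousOn
  unfold JC at *
  have := Complex.continuous_conj.comp hg
  fun_prop

lemma inner2_sum_left {ι : Type*} (s : Finset ι) (c : ι → ℂ) (F : ι → ℝ → ℝ → ℂ) (g : ℝ → ℝ → ℂ)
    (hF : ∀ i, JC (F i)) (hg : JC g) :
    inner2 (fun θ φ => ∑ i ∈ s, c i * F i θ φ) g = ∑ i ∈ s, c i * inner2 (F i) g := by
  unfold inner2
  simp only [Finset.sum_mul]
  rw [integral_finsetSum]
  · rw [Finset.mul_sum]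
    refine Finset.sum_congr rfl fun i _ => ?_
    simp only [mul_assoc]
    rw [integral_const_mul]
    ring
  · intro i _
    simpa only [mul_assoc] using (inner2_int (hF i) hg).const_mul (c i)

lemma inner2_sum_right {ι : Type*} (s : Finset ι) (c : ι → ℂ) (F : ι → ℝ → ℝ → ℂ) (g : ℝ → ℝ → ℂ)
    (hF : ∀ i, JC (F i)) (hg : JC g) :
    inner2 g (fun θ φ => ∑ i ∈ s, c i * F i θ φ) =
      ∑ i ∈ s, (starRingEnd ℂ) (c i) * inner2 g (F i) := by
  unfold inner2
  simp only [map_sum, map_mul, Finset.mul_sum, Finset.sum_mul]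
  rw [integral_finsetSum]
  · rw [Finset.mul_sum]
    refine Finset.sum_congr rfl fun i _ => ?_
    rw [← integral_const_mul, ← integral_const_mul, ← integral_const_mul]
    congr 1; funext q; ring
  · intro i _
    refine ((inner2_int hg (hF i)).const_mul ((starRingEnd ℂ) (c i))).congr ?_
    filter_upwards with q
    ring

lemma phi_int (k k' : ℤ) :
    (∫ φ in Set.Icc (0 : ℝ) (2 * Real.pi), Complex.exp (Complex.I * ((k - k' : ℤ) : ℂ) * (φ : ℂ)))
      = if k = k' then ((2 * Real.pi : ℝ) : ℂ) else 0 := by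
  have h2 : (0 : ℝ) ≤ 2 * Real.pi := by positivity
  rw [integral_Icc_eq_integral_Ioc, ← intervalIntegral.integral_of_le h2]
  split_ifs with h
  · subst h; simp
  · have hc : Complex.I * ((k - k' : ℤ) : ℂ) ≠ 0 := by
      refine mul_ne_zero Complex.I_ne_zero ?_
      exact_mod_cast sub_ne_zero.mpr h
    rw [integral_exp_mul_complex hc]
    have := Complex.exp_int_mul_two_pi_mul_I (k - k')
    rw [show Complex.I * ((k - k' : ℤ) : ℂ) * ((2 * Real.pi : ℝ) : ℂ)
      = ((k - k' : ℤ) : ℂ) * (2 * Real.pi * Complex.I) by push_cast; ring, this]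
    simp

lemma Y_orth (l l' : ℕ) (k k' : ℤ) (h : k.natAbs ≤ l) (h' : k'.natAbs ≤ l') :
    inner2 (Y l k) (Y l' k') = if l = l' ∧ k = k' then 1 else 0 := by
  have key : inner2 (Y l k) (Y l' k') = (1 / (4 * Real.pi)) *
      ((∫ θ in Set.Icc (0 : ℝ) Real.pi, ((Real.sin θ ^ (k.natAbs + k'.natAbs + 1) *
        (p (k.natAbs : ℝ) (l - k.natAbs) (Real.cos θ) *
          p (k'.natAbs : ℝ) (l' - k'.natAbs) (Real.cos θ)) : ℝ) : ℂ)) *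
      (∫ φ in Set.Icc (0 : ℝ) (2 * Real.pi),
        Complex.exp (Complex.I * ((k - k' : ℤ) : ℂ) * (φ : ℂ)))) := by
    rw [← setIntegral_prod_mul, ← Measure.volume_eq_prod]
    unfold inner2 region Y
    congr 2
    funext q
    have e : Complex.exp (Complex.I * ((k - k' : ℤ) : ℂ) * (q.2 : ℂ)) =
        Complex.exp (Complex.I * k * q.2) * (starRingEnd ℂ) (Complex.exp (Complex.I * k' * q.2)) := by
      rw [← Complex.exp_conj, ← Complex.exp_add]
      congr 1
      simp
      ring
    rw [e]
    simp only [map_mul, Complex.conj_ofReal]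
    push_cast
    ring
  rw [key, phi_int]
  by_cases hk : k = k'
  · subst hk
    rw [integral_complex_ofReal, integral_Icc_eq_integral_Ioc,
      ← intervalIntegral.integral_of_le Real.pi_pos.le]
    have := gram k.natAbs (l - k.natAbs) (l' - k.natAbs)
    unfold Iw at this
    rw [← two_mul, this]
    have hpi : (Real.pi : ℂ) ≠ 0 := by exact_mod_cast Real.pi_ne_zero
    by_cases hl : l = l'
    · subst hl; simp; field_simp; norm_num
    · rw [if_neg (by omega)]; simp [hl]
  · simp [hk]

lemma Mop_Y_succ (l : ℕ) (k : ℤ) (h : k.natAbs < l) :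
    Mop (Y l k) = fun θ φ => ∑ i : Fin 2, ![((b k.natAbs (l - k.natAbs + 1) : ℝ) : ℂ),
      ((b k.natAbs (l - k.natAbs) : ℝ) : ℂ)] i * ![Y (l + 1) k, Y (l - 1) k] i θ φ := by
  funext θ φ
  obtain ⟨j, rfl⟩ : ∃ j, l = k.natAbs + j + 1 := ⟨l - k.natAbs - 1, by omega⟩
  have e := p_rec k.natAbs j (Real.cos θ)
  simp only [Fin.sum_univ_two, Mop, Y, Matrix.cons_val_zero, Matrix.cons_val_one]
  rw [show k.natAbs + j + 1 + 1 - k.natAbs = j + 2 by omega,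
    show k.natAbs + j + 1 - 1 - k.natAbs = j by omega,
    show k.natAbs + j + 1 - k.natAbs = j + 1 by omega]
  have e' := congrArg (fun x : ℝ => (x : ℂ)) e
  simp only [Complex.ofReal_mul, Complex.ofReal_add] at e'
  linear_combination ((Real.sin θ ^ k.natAbs : ℝ) : ℂ) *
    Complex.exp (Complex.I * (k : ℂ) * (φ : ℂ)) * e'

lemma Mop_Y_zero (k : ℤ) :
    Mop (Y k.natAbs k) = fun θ φ => ∑ _i : Fin 1, ((b k.natAbs 1 : ℝ) : ℂ)
       * Y (k.natAbs + 1) k θ φ := by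
  funext θ φ
  have e := p_rec0 k.natAbs (Real.cos θ)
  simp only [Mop, Y, Finset.sum_const, Finset.card_univ, Fintype.card_fin, one_smul]
  rw [show k.natAbs + 1 - k.natAbs = 1 by omega,
    show k.natAbs - k.natAbs = 0 by omega]
  have e' := congrArg (fun x : ℝ => (x : ℂ)) e
  simp only [Complex.ofReal_mul] at e'
  linear_combination ((Real.sin θ ^ k.natAbs : ℝ) : ℂ) *
    Complex.exp (Complex.I * (k : ℂ) * (φ : ℂ)) * e'

lemma inner_MY (m l l' : ℕ) (k k' : ℤ) (hl : m ≤ l) (hl' : m ≤ l') (h : k.natAbs ≤ l)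
    (h' : k'.natAbs ≤ l') :
    inner2 (Mop (Y l k)) (Y l' k') = if k = k' then
          ((JE (k.natAbs : ℝ) (m - k.natAbs)
              (l - max k.natAbs m) (l' - max k.natAbs m) : ℝ) : ℂ)
        else 0 := by
  rcases Nat.eq_or_lt_of_le h with he | hlt
  · subst he
    rw [Mop_Y_zero, inner2_sum_left Finset.univ (fun _ => ((b k.natAbs 1 : ℝ) : ℂ))
      (fun _ : Fin 1 => Y (k.natAbs + 1) k) _ (fun _ => Y_JC _ _) (Y_JC _ _)]
    simp only [Finset.sum_const, Finset.card_univ, Fintype.card_fin, one_smul]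
    rw [Y_orth _ _ _ _ (by omega) h']
    by_cases hk : k = k'
    · subst hk
      unfold JE
      by_cases hl2 : k.natAbs + 1 = l'
      · subst hl2
        rw [if_pos ⟨rfl, rfl⟩, if_pos rfl, if_pos (by omega),
          show m - k.natAbs + (k.natAbs - max k.natAbs m) + 1 = 1 by omega]
        simp
      · rw [if_neg (by tauto), if_pos rfl, if_neg (by omega), if_neg (by omega)]; simp
    · simp [hk]
  · rw [Mop_Y_succ l k hlt, inner2_sum_left Finset.univ _ _ _
      (by intro i; fin_cases i <;> exact Y_JC _ _) (Y_JC _ _)]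
    simp only [Fin.sum_univ_two, Matrix.cons_val_zero, Matrix.cons_val_one]
    rw [Y_orth _ _ _ _ (by omega) h', Y_orth _ _ _ _ (by omega) h']
    by_cases hk : k = k'
    · subst hk
      unfold JE
      by_cases hl2 : l + 1 = l'
      · subst hl2
        rw [if_pos ⟨rfl, rfl⟩, if_neg (by omega), if_pos rfl, if_pos (by omega),
          show m - k.natAbs + (l - max k.natAbs m) + 1 = l - k.natAbs + 1 by omega]
        simp
      · by_cases hl3 : l - 1 = l'
        · subst hl3
          rw [if_neg (by omega), if_pos ⟨rfl, rfl⟩, if_pos rfl, if_neg (by omega), if_pos (by omega),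
            show m - k.natAbs + (l - 1 - max k.natAbs m) + 1 = l - k.natAbs by omega]
          simp
        · rw [if_neg (by tauto), if_neg (by tauto), if_pos rfl, if_neg (by omega),
            if_neg (by omega)]
          simp
    · simp [hk]

/-- Index set of the spherical harmonics in `Π_n^m`. -/
def IS (n m : ℕ) : Finset (Σ _ : ℕ, ℤ) :=
  (Finset.Icc m n).sigma fun l => Finset.Icc (-(l : ℤ)) (l : ℤ)

lemma mem_IS {n m : ℕ} {x : Σ _ : ℕ, ℤ} : x ∈ IS n m ↔ m ≤ x.1 ∧ x.1 ≤ n ∧ x.2.natAbs ≤ x.1 := by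
  simp only [IS, Finset.mem_sigma, Finset.mem_Icc]
  omega

lemma sum_IS (n m : ℕ) (F : ℕ → ℤ → ℂ) :
    (∑ l ∈ Finset.Icc m n, ∑ k ∈ Finset.Icc (-(l : ℤ)) (l : ℤ), F l k) =
      ∑ x ∈ IS n m, F x.1 x.2 := by
  rw [IS, Finset.sum_sigma]

lemma Pr_eq (n m : ℕ) (f : ℝ → ℝ → ℂ) :
    Pr n m f = fun θ φ => ∑ x ∈ IS n m, inner2 f (Y x.1 x.2) * Y x.1 x.2 θ φ := by
  funext θ φ
  exact sum_IS n m (fun l k => inner2 f (Y l k) * Y l k θ φ)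

lemma sum_Y_inner (n m : ℕ) (d : (Σ _ : ℕ, ℤ) → ℂ) (y : Σ _ : ℕ, ℤ) (hy : y ∈ IS n m) :
    inner2 (fun θ φ => ∑ x ∈ IS n m, d x * Y x.1 x.2 θ φ) (Y y.1 y.2) = d y := by
  rw [inner2_sum_left (IS n m) d (fun x => Y x.1 x.2) _ (fun _ => Y_JC _ _) (Y_JC _ _)]
  rw [Finset.sum_eq_single_of_mem y hy]
  · rw [Y_orth _ _ _ _ (mem_IS.mp hy).2.2 (mem_IS.mp hy).2.2]; simp
  · intro x hx hxy
    rw [Y_orth _ _ _ _ (mem_IS.mp hx).2.2 (mem_IS.mp hy).2.2, if_neg, mul_zero]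
    rintro ⟨h1, h2⟩
    apply hxy
    cases x; cases y
    simp_all

lemma Pr_sum (n m : ℕ) (d : (Σ _ : ℕ, ℤ) → ℂ) :
    Pr n m (fun θ φ => ∑ x ∈ IS n m, d x * Y x.1 x.2 θ φ) =
      fun θ φ => ∑ x ∈ IS n m, d x * Y x.1 x.2 θ φ := by
  rw [Pr_eq]
  funext θ φ
  exact Finset.sum_congr rfl fun x hx => by rw [sum_Y_inner n m d x hx]

lemma Pr_inner (n m : ℕ) (f : ℝ → ℝ → ℂ) (y : Σ _ : ℕ, ℤ) (hy : y ∈ IS n m) :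
    inner2 (Pr n m f) (Y y.1 y.2) = inner2 f (Y y.1 y.2) := by
  rw [Pr_eq]
  exact sum_Y_inner n m (fun x => inner2 f (Y x.1 x.2)) y hy

lemma sum_JC {ι : Type*} (s : Finset ι) (c : ι → ℂ) (F : ι → ℝ → ℝ → ℂ) (hF : ∀ i, JC (F i)) :
    JC (fun θ φ => ∑ i ∈ s, c i * F i θ φ) := by
  unfold JC at *
  exact continuous_finsetSum _ fun i _ => (hF i).const_mul _

lemma Pr_JC (n m : ℕ) (f : ℝ → ℝ → ℂ) : JC (Pr n m f) := by
  rw [Pr_eq]; exact sum_JC _ _ _ fun _ => Y_JC _ _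

lemma Y_as_sum (n m : ℕ) (y : Σ _ : ℕ, ℤ) (hy : y ∈ IS n m) :
    Y y.1 y.2 = fun θ φ => ∑ x ∈ IS n m, (if x = y then 1 else 0) * Y x.1 x.2 θ φ := by
  funext θ φ
  simp [hy]

lemma eps_eq (f : ℝ → ℝ → ℂ) : ((eps f : ℝ) : ℂ) = inner2 (Mop f) f := by
  unfold eps inner2 Mop
  rw [Complex.ofReal_mul, ← integral_complex_ofReal]
  congr 1
  · simp
  · congr 1; funext q
    rw [mul_assoc (Complex.ofReal _) (f _ _), Complex.mul_conj, Complex.normSq_eq_norm_sq]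
    push_cast
    rfl

lemma sum_reindex (n m : ℕ) (hmn : m ≤ n) (F : ℕ → ℤ → ℂ) :
    (∑ x ∈ IS n m, F x.1 x.2) = ∑ k ∈ Finset.Icc (-(n : ℤ)) (n : ℤ),
        ∑ i ∈ Finset.range (Nk n m k.natAbs), F (max k.natAbs m + i) k := by
  rw [Finset.sum_sigma']
  refine Finset.sum_bij' (fun x _ => ⟨x.2, x.1 - max x.2.natAbs m⟩)
    (fun y _ => ⟨max y.1.natAbs m + y.2, y.1⟩) ?_ ?_ ?_ ?_ ?_
  · rintro ⟨l, k⟩ hx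
    have := mem_IS.mp hx
    simp only [Finset.mem_sigma, Finset.mem_Icc, Finset.mem_range, Nk] at *
    omega
  · rintro ⟨k, i⟩ hy
    rw [mem_IS]
    simp only [Finset.mem_sigma, Finset.mem_Icc, Finset.mem_range, Nk] at *
    omega
  · rintro ⟨l, k⟩ hx
    have := mem_IS.mp hx
    simp only at *
    congr 1
    omega
  · rintro ⟨k, i⟩ hy
    simp
  · rintro ⟨l, k⟩ hx
    have := mem_IS.mp hx
    simp only at *
    congr 1
    omega

lemma JE_symm (α : ℝ) (M i j : ℕ) : JE α M i j = JE α M j i := by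
  unfold JE
  split_ifs <;> first | rfl | omega

/-- for `Q = Σ_{l=m}^n Σ_{k=−l}^l c_{l,k} Y_l^k ∈ Π_n^m`,
`ε(Q) = ⟨P_n^m M P_n^m Q, Q⟩ = Σ_k c_k^H J(|k|) c_k` (blockwise quadratic forms), and the
operator `P_n^m M P_n^m` restricted to `Π_n^m` is unitarily equivalent, via the map sending
the canonical basis vectors to the spherical harmonics, to the block diagonal matrix
`𝒥_n^m` with blocks `J(|k|)_{n−|k|}^{m−|k|}` (`|k| ≤ m`) and `J(|k|)_{n−|k|}` (`m+1 ≤ |k| ≤ n`),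
i.e. the matrix of `P_n^m M P_n^m` in the basis of spherical harmonics is `𝒥_n^m`. -/
theorem stmt6 (n m : ℕ) (hmn : m ≤ n) (c : ℕ → ℤ → ℂ)
    (Q : ℝ → ℝ → ℂ)
    (hQ : Q = fun θ φ => ∑ l ∈ Finset.Icc m n, ∑ k ∈ Finset.Icc (-(l : ℤ)) (l : ℤ),
      c l k * Y l k θ φ) :
    inner2 (SFop n m Q) Q = ((eps Q : ℝ) : ℂ) ∧
    ((eps Q : ℝ) : ℂ) =
      ∑ k ∈ Finset.Icc (-(n : ℤ)) (n : ℤ),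
        ∑ i ∈ Finset.range (Nk n m k.natAbs), ∑ j ∈ Finset.range (Nk n m k.natAbs),
          (starRingEnd ℂ) (c (max k.natAbs m + i) k) *
            ((JE (k.natAbs : ℝ) (m - k.natAbs) i j : ℝ) : ℂ) * c (max k.natAbs m + j) k ∧
    (∀ l l' : ℕ, ∀ k k' : ℤ, m ≤ l → l ≤ n → m ≤ l' → l' ≤ n →
      k.natAbs ≤ l → k'.natAbs ≤ l' →
      inner2 (SFop n m (Y l k)) (Y l' k') =
        if k = k' then
          ((JE (k.natAbs : ℝ) (m - k.natAbs)
              (l - max k.natAbs m) (l' - max k.natAbs m) : ℝ) : ℂ)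
        else 0) := by
  have hQ' : Q = fun θ φ => ∑ x ∈ IS n m, c x.1 x.2 * Y x.1 x.2 θ φ := by
    rw [hQ]; funext θ φ
    exact sum_IS n m (fun l k => c l k * Y l k θ φ)
  have hQc : JC Q := by rw [hQ']; exact sum_JC _ _ _ fun _ => Y_JC _ _
  have hPQ : Pr n m Q = Q := by rw [hQ']; exact Pr_sum n m (fun x => c x.1 x.2)
  have right : ∀ g, JC g → inner2 g Q =
      ∑ x ∈ IS n m, (starRingEnd ℂ) (c x.1 x.2) * inner2 g (Y x.1 x.2) := by
    intro g hg
    rw [hQ']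
    exact inner2_sum_right (IS n m) (fun x => c x.1 x.2) (fun x => Y x.1 x.2) g
      (fun _ => Y_JC _ _) hg
  refine ⟨?_, ?_, ?_⟩
  · rw [eps_eq, SFop, hPQ, right _ (Pr_JC _ _ _), right _ (Mop_JC hQc)]
    exact Finset.sum_congr rfl fun x hx => by rw [Pr_inner n m _ x hx]
  · rw [eps_eq, right _ (Mop_JC hQc)]
    have hM : Mop Q = fun θ φ => ∑ x ∈ IS n m, c x.1 x.2 * Mop (Y x.1 x.2) θ φ := by
      rw [hQ']; funext θ φ
      simp only [Mop, Finset.mul_sum]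
      exact Finset.sum_congr rfl fun x _ => by ring
    have left : ∀ y : (Σ _ : ℕ, ℤ), y ∈ IS n m → inner2 (Mop Q) (Y y.1 y.2) =
        ∑ x ∈ IS n m, c x.1 x.2 * (if x.2 = y.2 then
          ((JE (x.2.natAbs : ℝ) (m - x.2.natAbs)
              (x.1 - max x.2.natAbs m) (y.1 - max x.2.natAbs m) : ℝ) : ℂ)
        else 0) := by
      intro y hy
      rw [hM, inner2_sum_left (IS n m) (fun x => c x.1 x.2) (fun x => Mop (Y x.1 x.2)) _
        (fun _ => Mop_JC (Y_JC _ _)) (Y_JC _ _)]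
      refine Finset.sum_congr rfl fun x hx => ?_
      have hx' := mem_IS.mp hx
      have hy' := mem_IS.mp hy
      rw [inner_MY m _ _ _ _ hx'.1 hy'.1 hx'.2.2 hy'.2.2]
    rw [Finset.sum_congr rfl fun y hy => by rw [left y hy]]
    rw [sum_reindex n m hmn (fun l k => (starRingEnd ℂ) (c l k) * ∑ x ∈ IS n m,
      c x.1 x.2 * (if x.2 = k then
          ((JE (x.2.natAbs : ℝ) (m - x.2.natAbs)
              (x.1 - max x.2.natAbs m) (l - max x.2.natAbs m) : ℝ) : ℂ)
        else 0))]
    refine Finset.sum_congr rfl fun k hk => Finset.sum_congr rfl fun i hi => ?_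
    rw [sum_reindex n m hmn (fun l' k' => c l' k' * (if k' = k then
          ((JE (k'.natAbs : ℝ) (m - k'.natAbs)
              (l' - max k'.natAbs m) (max k.natAbs m + i - max k'.natAbs m) : ℝ) : ℂ)
        else 0)), Finset.sum_eq_single_of_mem k hk, Finset.mul_sum]
    · refine Finset.sum_congr rfl fun j _ => ?_
      rw [if_pos rfl, Nat.add_sub_cancel_left, Nat.add_sub_cancel_left, JE_symm]
      ring
    · intro k' _ hne
      simp [hne]
  · intro l l' k k' h1 h2 h3 h4 h5 h6
    have hy : (⟨l, k⟩ : Σ _ : ℕ, ℤ) ∈ IS n m := mem_IS.mpr ⟨h1, h2, h5⟩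
    have hy' : (⟨l', k'⟩ : Σ _ : ℕ, ℤ) ∈ IS n m := mem_IS.mpr ⟨h3, h4, h6⟩
    have hP : Pr n m (Y l k) = Y l k := by
      rw [Y_as_sum n m _ hy]; exact Pr_sum n m _
    rw [SFop, hP, Pr_inner n m _ _ hy', inner_MY m l l' k k' h1 h3 h5 h6]
end SFT
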